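/- Let ℓ ≥ 2 be an integer, α ≥ 1 a real number, and let X_1,…,X_ℓ be nonnegative real-valued random variables (possibly dependent) on a probability space with E[X_t] ≤ α for every 1 ≤ t ≤ ℓ. Define the counter process C_0 = 0 and C_t = max(X_t + C_{t−1} − r, 0) for 1 ≤ t ≤ ℓ. If r ≥ 4·α·log₂(ℓ), then for every 0 ≤ t ≤ ℓ one has Pr[C_t = 0] ≥ 1/2. -/

import Mathlib

open MeasureTheory
open scoped ENNReal

/-- Unrolling the counter recursion back to the last time the maximum was attained at `0`. -/
lemma exists_counter_eq_sum {ℓ : ℕ} {r : ℝ} {x c : ℕ → ℝ} (hc0 : c 0 = 0)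
    (hc : ∀ t, 1 ≤ t → t ≤ ℓ → c t = max (x t + c (t - 1) - r) 0) :
    ∀ t ≤ ℓ, ∃ s ≤ t, c t = ∑ i ∈ Finset.Ico s t, x (i + 1) - r * ((t : ℝ) - s) := by
  intro t
  induction t with
  | zero => exact fun _ => ⟨0, le_rfl, by simp [hc0]⟩
  | succ t ih =>
    intro ht
    obtain ⟨s, hs, h⟩ := ih (by omega)
    have hstep := hc (t + 1) (by omega) ht
    rw [Nat.add_sub_cancel] at hstep
    rcases max_choice (x (t + 1) + c t - r) 0 with hm | hm
    · refine ⟨s, by omega, ?_⟩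
      rw [hstep, hm, h, Finset.sum_Ico_succ_top hs]
      push_cast
      ring
    · exact ⟨t + 1, le_rfl, by rw [hstep, hm]; simp⟩

/-- A nonzero counter forces the harmonically weighted sum of the past increments above `r`. -/
lemma lt_weighted_sum_of_counter_ne_zero {ℓ : ℕ} {r : ℝ} {x c : ℕ → ℝ}
    (hx : ∀ t, 1 ≤ t → t ≤ ℓ → 0 ≤ x t) (hc0 : c 0 = 0)
    (hc : ∀ t, 1 ≤ t → t ≤ ℓ → c t = max (x t + c (t - 1) - r) 0)
    {t : ℕ} (ht : t ≤ ℓ) (hne : c t ≠ 0) :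
    r < ∑ i ∈ Finset.range t, ((t : ℝ) - i)⁻¹ * x (i + 1) := by
  have hpos : 0 < c t := by
    rcases Nat.eq_zero_or_pos t with rfl | h
    · exact absurd hc0 hne
    · exact lt_of_le_of_ne (by rw [hc t h ht]; exact le_max_right _ _) hne.symm
  obtain ⟨s, hs, h⟩ := exists_counter_eq_sum hc0 hc t ht
  have hst : s < t := by
    refine lt_of_le_of_ne hs ?_
    rintro rfl
    simp [h] at hpos
  have hd : (0 : ℝ) < (t : ℝ) - s := sub_pos.2 (by exact_mod_cast hst)
  calc r < ((t : ℝ) - s)⁻¹ * ∑ i ∈ Finset.Ico s t, x (i + 1) := by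
        rw [inv_mul_eq_div, lt_div_iff₀ hd]
        linarith
    _ ≤ ∑ i ∈ Finset.Ico s t, ((t : ℝ) - i)⁻¹ * x (i + 1) := by
        rw [Finset.mul_sum]
        refine Finset.sum_le_sum fun i hi => ?_
        rw [Finset.mem_Ico] at hi
        have h0 : (0 : ℝ) < (t : ℝ) - i := sub_pos.2 (by exact_mod_cast hi.2)
        have h1 : (s : ℝ) ≤ i := by exact_mod_cast hi.1
        exact mul_le_mul_of_nonneg_right (inv_anti₀ h0 (by linarith))
          (hx _ (by omega) (by omega))
    _ ≤ ∑ i ∈ Finset.range t, ((t : ℝ) - i)⁻¹ * x (i + 1) := by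
        refine Finset.sum_le_sum_of_subset_of_nonneg (fun i hi => ?_) fun i hi _ => ?_
        · exact Finset.mem_range.2 (Finset.mem_Ico.1 hi).2
        · rw [Finset.mem_range] at hi
          have h0 : (0 : ℝ) < (t : ℝ) - i := sub_pos.2 (by exact_mod_cast hi)
          exact mul_nonneg (inv_nonneg.2 h0.le) (hx _ (by omega) (by omega))

lemma sum_range_inv_sub_eq_harmonic (t : ℕ) :
    ∑ i ∈ Finset.range t, ((t : ℝ) - i)⁻¹ = (harmonic t : ℝ) := by
  rw [harmonic, ← Finset.sum_range_reflect]
  push_cast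
  refine Finset.sum_congr rfl fun i hi => ?_
  rw [Finset.mem_range] at hi
  congr 1
  rw [Nat.sub_sub, Nat.cast_sub (by omega)]
  push_cast
  ring

lemma harmonic_le_two_mul_logb {t ℓ : ℕ} (hℓ : 2 ≤ ℓ) (ht : t ≤ ℓ) :
    (harmonic t : ℝ) ≤ 2 * Real.logb 2 ℓ := by
  have hℓ' : (2 : ℝ) ≤ ℓ := by exact_mod_cast hℓ
  have hlog : 0 ≤ Real.log ℓ := Real.log_nonneg (by linarith)
  have hone : 1 ≤ Real.logb 2 ℓ := by
    rw [Real.le_logb_iff_rpow_le (by norm_num) (by linarith)]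
    simpa using hℓ'
  have hle : Real.log ℓ ≤ Real.logb 2 ℓ := by
    rw [Real.logb, le_div_iff₀ (Real.log_pos (by norm_num))]
    nlinarith [Real.log_two_lt_d9]
  have hmono : (harmonic t : ℝ) ≤ harmonic ℓ := by
    rw [harmonic, harmonic]
    push_cast
    exact Finset.sum_le_sum_of_subset_of_nonneg (Finset.range_mono ht)
      fun i _ _ => by positivity
  linarith [harmonic_le_one_add_log ℓ]

/-- If `r ≥ 4·α·log₂ ℓ`, the counter process `C_0 = 0`,
`C_t = max (X_t + C_{t-1} - r) 0` built from (possibly dependent) nonnegative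
random variables with `E[X_t] ≤ α` satisfies `Pr[C_t = 0] ≥ 1/2` for all `t ≤ ℓ`. -/
theorem counter_lemma {Ω : Type*} [MeasurableSpace Ω] (μ : Measure Ω)
    [IsProbabilityMeasure μ]
    (ℓ : ℕ) (hℓ : 2 ≤ ℓ) (α r : ℝ) (hα : 1 ≤ α)
    (hr : 4 * α * Real.logb 2 ℓ ≤ r)
    (X : ℕ → Ω → ℝ)
    (hXmeas : ∀ t, 1 ≤ t → t ≤ ℓ → Measurable (X t))
    (hXnonneg : ∀ t, 1 ≤ t → t ≤ ℓ → ∀ ω, 0 ≤ X t ω)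
    (hXint : ∀ t, 1 ≤ t → t ≤ ℓ → Integrable (X t) μ)
    (hXexp : ∀ t, 1 ≤ t → t ≤ ℓ → ∫ ω, X t ω ∂μ ≤ α)
    (C : ℕ → Ω → ℝ)
    (hC0 : ∀ ω, C 0 ω = 0)
    (hC : ∀ t, 1 ≤ t → t ≤ ℓ → ∀ ω, C t ω = max (X t ω + C (t - 1) ω - r) 0) :
    ∀ t ≤ ℓ, (1 : ℝ≥0∞) / 2 ≤ μ {ω | C t ω = 0} := by
  intro t ht
  set Z : Ω → ℝ := fun ω => ∑ i ∈ Finset.range t, ((t : ℝ) - i)⁻¹ * X (i + 1) ω with hZ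
  have hlog : 1 ≤ Real.logb 2 ℓ := by
    have hℓ' : (2 : ℝ) ≤ ℓ := by exact_mod_cast hℓ
    rw [Real.le_logb_iff_rpow_le (by norm_num) (by linarith)]
    simpa using hℓ'
  have hrpos : 0 < r := by nlinarith
  have hw : ∀ i ∈ Finset.range t, 0 ≤ ((t : ℝ) - i)⁻¹ := fun i hi =>
    inv_nonneg.2 (sub_nonneg.2 (by exact_mod_cast (Finset.mem_range.1 hi).le))
  have hidx : ∀ i ∈ Finset.range t, 1 ≤ i + 1 ∧ i + 1 ≤ ℓ := fun i hi => by
    rw [Finset.mem_range] at hi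
    omega
  have hterm : ∀ i ∈ Finset.range t,
      Integrable (fun ω => ((t : ℝ) - i)⁻¹ * X (i + 1) ω) μ := fun i hi =>
    (hXint _ (hidx i hi).1 (hidx i hi).2).const_mul _
  have hZmeas : Measurable Z := Finset.measurable_fun_sum _ fun i hi =>
    (hXmeas _ (hidx i hi).1 (hidx i hi).2).const_mul _
  have hZint : Integrable Z μ := integrable_finsetSum _ hterm
  have hZnonneg : 0 ≤ Z := fun ω => Finset.sum_nonneg fun i hi =>
    mul_nonneg (hw i hi) (hXnonneg _ (hidx i hi).1 (hidx i hi).2 ω)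
  have hZexp : ∫ ω, Z ω ∂μ ≤ r / 2 := by
    calc ∫ ω, Z ω ∂μ = ∑ i ∈ Finset.range t, ((t : ℝ) - i)⁻¹ * ∫ ω, X (i + 1) ω ∂μ := by
          rw [hZ, integral_finsetSum _ hterm]
          simp_rw [integral_const_mul]
      _ ≤ ∑ i ∈ Finset.range t, ((t : ℝ) - i)⁻¹ * α := Finset.sum_le_sum fun i hi =>
          mul_le_mul_of_nonneg_left (hXexp _ (hidx i hi).1 (hidx i hi).2) (hw i hi)
      _ = harmonic t * α := by rw [← Finset.sum_mul, sum_range_inv_sub_eq_harmonic]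
      _ ≤ r / 2 := by nlinarith [harmonic_le_two_mul_logb hℓ ht]
  have hmarkov : μ.real {ω | r ≤ Z ω} ≤ 1 / 2 := by
    have h := mul_meas_ge_le_integral_of_nonneg (ae_of_all _ hZnonneg) hZint r
    exact le_of_mul_le_mul_left (by linarith) hrpos
  have hsub : {ω | r ≤ Z ω}ᶜ ⊆ {ω | C t ω = 0} := by
    intro ω hω
    by_contra hne
    exact hω (lt_weighted_sum_of_counter_ne_zero (x := fun t => X t ω) (c := fun t => C t ω)
      (fun t h1 h2 => hXnonneg t h1 h2 ω) (hC0 ω) (fun t h1 h2 => hC t h1 h2 ω) ht hne).le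
  have hcompl : 1 / 2 ≤ μ.real {ω | r ≤ Z ω}ᶜ := by
    rw [probReal_compl_eq_one_sub (measurableSet_le measurable_const hZmeas)]
    linarith
  refine le_trans ?_ (measure_mono hsub)
  rw [← ofReal_measureReal]
  refine le_trans (le_of_eq ?_) (ENNReal.ofReal_le_ofReal hcompl)
  rw [ENNReal.ofReal_div_of_pos (by norm_num)]
  simp
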